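/- Let m>1, 0<p<1, σ>2(1−p)/(m−1). If f is a positive C² solution of the profile ODE on an interval (R,∞), R>0, satisfying lim_{ξ→∞} ξ^{σ} f(ξ)^{p−1} = ∞, then f is strictly decreasing on some interval (R',∞) with R'≥R, and f(ξ)→0 as ξ→∞. -/

import Mathlib

open Real Filter Set Topology

/-- The function `f^m` (real power). -/
noncomputable def Fm (m : ℝ) (f : ℝ → ℝ) : ℝ → ℝ := fun ξ => f ξ ^ m

/-- `f` solves the self-similar profile ODE
`(f^m)'' - α f + β ξ f' + ξ^σ f^p = 0` on the set `S`. -/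
noncomputable def SolvesODE (m p σ α β : ℝ) (f : ℝ → ℝ) (S : Set ℝ) : Prop :=
  ∀ ξ ∈ S,
    deriv (deriv (Fm m f)) ξ - α * f ξ + β * ξ * deriv f ξ + ξ ^ σ * f ξ ^ p = 0

/-- A profile: continuous and nonnegative on `[0,∞)`, with `f^m` of class `C²`
on the (positive-space) positivity set, solving the profile ODE there. -/
noncomputable def IsProfile (m p σ α β : ℝ) (f : ℝ → ℝ) : Prop :=
  ContinuousOn f (Set.Ici 0) ∧ (∀ ξ ∈ Set.Ici (0 : ℝ), 0 ≤ f ξ) ∧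
    ContDiffOn ℝ 2 (Fm m f) {ξ : ℝ | 0 < ξ ∧ 0 < f ξ} ∧
    SolvesODE m p σ α β f {ξ : ℝ | 0 < ξ ∧ 0 < f ξ}

/-- Behavior (P1) at the origin: `f(0) = a > 0`, `f'(0) = 0`. -/
noncomputable def GoodP1 (f : ℝ → ℝ) : Prop :=
  0 < f 0 ∧ HasDerivWithinAt f 0 (Set.Ici 0) 0

/-- Behavior (P2) at the origin: `f(0) = 0`, `(f^m)'(0) = 0`. -/
noncomputable def GoodP2 (m : ℝ) (f : ℝ → ℝ) : Prop :=
  f 0 = 0 ∧ HasDerivWithinAt (Fm m f) 0 (Set.Ici 0) 0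

/-- `f` has an interface at `ξ₀ ∈ (0,∞)`: `f(ξ₀) = 0`, `(f^m)'(ξ₀) = 0`, and
`f > 0` on a left-neighborhood of `ξ₀`. -/
noncomputable def HasInterface (m : ℝ) (f : ℝ → ℝ) (ξ₀ : ℝ) : Prop :=
  0 < ξ₀ ∧ f ξ₀ = 0 ∧ HasDerivAt (Fm m f) 0 ξ₀ ∧
    ∃ δ > 0, ∀ ξ ∈ Set.Ioo (ξ₀ - δ) ξ₀, 0 < f ξ

/-- Type I interface behavior at `ξ₀`: `f(ξ)(ξ₀-ξ)^{-1/(m-1)}` has a finite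
positive limit as `ξ → ξ₀⁻`. -/
noncomputable def TypeI (m : ℝ) (f : ℝ → ℝ) (ξ₀ : ℝ) : Prop :=
  ∃ L > 0, Filter.Tendsto (fun ξ => f ξ * (ξ₀ - ξ) ^ (-(1 / (m - 1))))
    (nhdsWithin ξ₀ (Set.Iio ξ₀)) (nhds L)

/-- Type II interface behavior at `ξ₀`: `f(ξ)(ξ₀-ξ)^{-1/(1-p)}` has a finite
positive limit as `ξ → ξ₀⁻`. -/
noncomputable def TypeII (p : ℝ) (f : ℝ → ℝ) (ξ₀ : ℝ) : Prop :=
  ∃ L > 0, Filter.Tendsto (fun ξ => f ξ * (ξ₀ - ξ) ^ (-(1 / (1 - p))))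
    (nhdsWithin ξ₀ (Set.Iio ξ₀)) (nhds L)

/-- A function on a half-line with derivative bounded above by a negative constant
tends to `-∞`. -/
theorem tendsto_atBot_of_deriv_le_neg {h : ℝ → ℝ} {A c : ℝ} (hc : 0 < c)
    (hd : ∀ x > A, DifferentiableAt ℝ h x) (hle : ∀ x > A, deriv h x ≤ -c) :
    Tendsto h atTop atBot := by
  have hlin : Tendsto (fun x : ℝ => h (A + 1) + -c * (x - (A + 1))) atTop atBot := by
    apply tendsto_atBot_add_const_left
    exact (tendsto_atTop_add_const_right atTop (-(A + 1)) tendsto_id).const_mul_atTop_of_neg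
      (neg_lt_zero.mpr hc)
  refine tendsto_atBot_mono' _ ?_ hlin
  filter_upwards [eventually_ge_atTop (A + 1)] with x hx
  have key := (convex_Ioi A).image_sub_le_mul_sub_of_deriv_le
    (fun y hy => (hd y hy).continuousAt.continuousWithinAt)
    (fun y hy => (hd y (interior_subset hy)).differentiableWithinAt)
    (fun y hy => hle y (interior_subset hy)) (A + 1) (by simp) x
    (show A < x by linarith) hx
  linarith

/-- If `u` is differentiable on a half-line, has negative derivative at each of its zeros
and is negative at `a`, then it stays negative after `a`. -/
theorem neg_of_deriv_neg_of_eq_zero {u : ℝ → ℝ} {A a : ℝ} (ha : A < a)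
    (hd : ∀ x > A, DifferentiableAt ℝ u x) (hz : ∀ x > A, u x = 0 → deriv u x < 0)
    (hua : u a < 0) : ∀ x > a, u x < 0 := by
  have hle : ∀ x ≥ a, u x ≤ 0 := fun x hx =>
    image_le_of_deriv_right_lt_deriv_boundary (f' := deriv u) (B := fun _ => 0)
      (B' := fun _ => 0) (a := a) (b := x)
      (fun y hy => (hd y (ha.trans_le hy.1)).continuousAt.continuousWithinAt)
      (fun y hy => (hd y (ha.trans_le hy.1)).hasDerivAt.hasDerivWithinAt) hua.le
      (fun y => hasDerivAt_const y 0)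
      (fun y hy h0 => hz y (ha.trans_le hy.1) h0) ⟨hx, le_rfl⟩
  intro x hx
  refine (hle x hx.le).lt_of_ne fun h0 => ?_
  have hmax : IsLocalMax u x := by
    filter_upwards [Ioi_mem_nhds hx] with y hy
    rw [h0]
    exact hle y (le_of_lt hy)
  exact (hz x (ha.trans hx) h0).ne hmax.deriv_eq_zero

/-- a positive `C²` solution of the profile ODE on `(R,∞)` with
`ξ^σ f(ξ)^{p-1} → ∞` as `ξ → ∞` is strictly decreasing on some `(R',∞)` with
`R' ≥ R`, and `f(ξ) → 0` as `ξ → ∞`. -/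
theorem decay_at_infinity (m p σ α β : ℝ)
    (hm : 1 < m) (hp0 : 0 < p) (hp1 : p < 1)
    (hσ : 2 * (1 - p) / (m - 1) < σ)
    (hα : α = (σ + 2) / (σ * (m - 1) + 2 * (p - 1)))
    (hβ : β = (m - p) / (σ * (m - 1) + 2 * (p - 1)))
    (f : ℝ → ℝ) (R : ℝ) (hR : 0 < R)
    (hpos : ∀ ξ ∈ Set.Ioi R, 0 < f ξ)
    (hf : ContDiffOn ℝ 2 f (Set.Ioi R))
    (hode : SolvesODE m p σ α β f (Set.Ioi R))
    (hlim : Filter.Tendsto (fun ξ => ξ ^ σ * f ξ ^ (p - 1))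
      Filter.atTop Filter.atTop) :
    ∃ R' : ℝ, R ≤ R' ∧ StrictAntiOn f (Set.Ioi R') ∧
      Filter.Tendsto f Filter.atTop (nhds 0) := by
  have hβ0 : 0 < β := by
    rw [div_lt_iff₀ (by linarith)] at hσ
    rw [hβ]
    exact div_pos (by linarith) (by linarith)
  have hdf : ∀ x > R, DifferentiableAt ℝ f x := fun x hx =>
    (hf.contDiffAt (Ioi_mem_nhds hx)).differentiableAt (by norm_num)
  have hw : ContDiffOn ℝ 2 (Fm m f) (Ioi R) :=
    hf.rpow_const_of_ne fun x hx => (hpos x hx).ne'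
  have hdw : ∀ x > R, DifferentiableAt ℝ (Fm m f) x := fun x hx =>
    (hw.contDiffAt (Ioi_mem_nhds hx)).differentiableAt (by norm_num)
  have hddw : ∀ x > R, DifferentiableAt ℝ (deriv (Fm m f)) x := fun x hx =>
    ((hw.deriv_of_isOpen (m := 1) isOpen_Ioi (by norm_num)).contDiffAt
      (Ioi_mem_nhds hx)).differentiableAt (by norm_num)
  have hderiv : ∀ x > R, deriv (Fm m f) x = (m * f x ^ (m - 1)) * deriv f x := fun x hx => by
    have := ((hdf x hx).hasDerivAt.rpow_const (p := m) (Or.inl (hpos x hx).ne')).deriv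
    unfold Fm
    rw [this]
    ring
  have hcoef : ∀ x > R, 0 < m * f x ^ (m - 1) := fun x hx =>
    mul_pos (by linarith) (rpow_pos_of_pos (hpos x hx) _)
  have hfp : ∀ x > R, x ^ σ * f x ^ p = f x * (x ^ σ * f x ^ (p - 1)) := fun x hx => by
    rw [rpow_sub_one (hpos x hx).ne']
    field_simp [(hpos x hx).ne']
  have hunb : ∀ c > 0, ∀ A, ∃ x > A, f x < c := by
    intro c hc A
    by_contra! hge
    obtain ⟨B, hB⟩ := eventually_atTop.mp (hlim.eventually_ge_atTop (α + β + 1))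
    set S := max R (max A B)
    have hS : ∀ x > S, R < x ∧ A < x ∧ B < x := fun x hx => by simpa [S] using hx
    have hg : Tendsto (fun x => deriv (Fm m f) x + β * (x * f x)) atTop atBot := by
      have hasd : ∀ x > S, HasDerivAt (fun x => deriv (Fm m f) x + β * (x * f x))
          (deriv (deriv (Fm m f)) x + β * (1 * f x + x * deriv f x)) x := fun x hx =>
        (hddw x (hS x hx).1).hasDerivAt.add
          (((hasDerivAt_id x).mul (hdf x (hS x hx).1).hasDerivAt).const_mul β)
      refine tendsto_atBot_of_deriv_le_neg hc (A := S)
        (fun x hx => (hasd x hx).differentiableAt) fun x hx => ?_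
      obtain ⟨hxR, hxA, hxB⟩ := hS x hx
      rw [(hasd x hx).deriv]
      have h1 := hode x hxR
      rw [hfp x hxR] at h1
      have h2 := mul_le_mul_of_nonneg_left (hB x hxB.le) (hpos x hxR).le
      have h3 := hge x hxA
      nlinarith
    obtain ⟨D, hD⟩ := eventually_atTop.mp (hg.eventually_le_atBot (-1))
    have hwbot : Tendsto (Fm m f) atTop atBot := by
      refine tendsto_atBot_of_deriv_le_neg one_pos (A := max R D)
        (fun x hx => hdw x (max_lt_iff.mp hx).1) fun x hx => ?_
      obtain ⟨hxR, hxD⟩ := max_lt_iff.mp hx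
      have h1 := hD x hxD.le
      have h2 : 0 < β * (x * f x) :=
        mul_pos hβ0 (mul_pos (hR.trans hxR) (hpos x hxR))
      linarith
    obtain ⟨x, hx, hxR⟩ :=
      ((hwbot.eventually_le_atBot 0).and (eventually_gt_atTop R)).exists
    exact hx.not_gt (rpow_pos_of_pos (hpos x hxR) m)
  obtain ⟨B, hB⟩ := eventually_atTop.mp (hlim.eventually_gt_atTop α)
  set S := max R B
  have hS : ∀ x > S, R < x ∧ B < x := fun x hx => max_lt_iff.mp hx
  obtain ⟨a, haS, ha⟩ : ∃ a > S, deriv f a < 0 := by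
    by_contra! hge
    have hmono : MonotoneOn f (Ioi S) := monotoneOn_of_deriv_nonneg (convex_Ioi S)
      (fun y hy => (hdf y (hS y hy).1).continuousAt.continuousWithinAt)
      (fun y hy => (hdf y (hS y (interior_subset hy)).1).differentiableWithinAt)
      (fun y hy => hge y (interior_subset hy))
    have hS1 : S < S + 1 := by linarith
    obtain ⟨x, hx, hlt⟩ := hunb (f (S + 1)) (hpos _ (hS _ hS1).1) (S + 1)
    exact (hmono hS1 (hS1.trans hx) hx.le).not_gt hlt
  have haR := (hS a haS).1
  have hneg : ∀ x > a, deriv (Fm m f) x < 0 := by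
    refine neg_of_deriv_neg_of_eq_zero haS (fun x hx => hddw x (hS x hx).1) ?_ ?_
    · intro x hx h0
      obtain ⟨hxR, hxB⟩ := hS x hx
      rw [hderiv x hxR] at h0
      have hf0 : deriv f x = 0 := (mul_eq_zero.mp h0).resolve_left (hcoef x hxR).ne'
      have h1 := hode x hxR
      rw [hfp x hxR, hf0] at h1
      have h2 := mul_lt_mul_of_pos_left (hB x hxB.le) (hpos x hxR)
      linarith
    · rw [hderiv a haR]
      exact mul_neg_of_pos_of_neg (hcoef a haR) ha
  have hanti : StrictAntiOn f (Ioi a) := strictAntiOn_of_deriv_neg (convex_Ioi a)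
    (fun y hy => (hdf y (haR.trans hy)).continuousAt.continuousWithinAt) fun y hy => by
      have hy' : a < y := interior_subset hy
      have h := hneg y hy'
      rw [hderiv y (haR.trans hy')] at h
      exact (pos_iff_neg_of_mul_neg h).mp (hcoef y (haR.trans hy'))
  refine ⟨a, haR.le, hanti, tendsto_order.mpr ⟨fun b hb => ?_, fun b hb => ?_⟩⟩
  · filter_upwards [eventually_gt_atTop R] with x hx using hb.trans (hpos x hx)
  · obtain ⟨x, hx, hlt⟩ := hunb b hb a
    filter_upwards [eventually_ge_atTop x] with y hy
    exact (hanti.antitoneOn hx (hx.trans_le hy) hy).trans_lt hlt
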